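/- Let D be a dendrite and f : D → D a continuous transitive map, and suppose (D,f) admits no terminal regular periodic decomposition. Then for every q ∈ D \ End(D) there exists a connected regular periodic decomposition (D_0, …, D_{m-1}) for (D,f) such that q ∈ D_i ∩ D_j for some i ≠ j. -/

import Mathlib

open Set Topology Filter TopologicalSpace

/-- A dendrite: a nondegenerate continuum in which any two distinct points can be
separated by a third point. -/
def IsDendrite (X : Type*) [TopologicalSpace X] : Prop :=
  Nontrivial X ∧ ∀ x y : X, x ≠ y → ∃ z : X, z ≠ x ∧ z ≠ y ∧
    connectedComponentIn ({z}ᶜ : Set X) x ≠ connectedComponentIn ({z}ᶜ : Set X) y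

/-- `p` is an endpoint of `X` if `X \ {p}` is connected. -/
def IsEndpointOf (X : Type*) [TopologicalSpace X] (p : X) : Prop :=
  IsPreconnected ({p}ᶜ : Set X)

/-- A periodic point of `f`. -/
def IsPeriodic {X : Type*} (f : X → X) (x : X) : Prop :=
  ∃ n : ℕ, 1 ≤ n ∧ f^[n] x = x

/-- `x` has dense forward orbit under `f`. -/
def HasDenseOrbit {X : Type*} [TopologicalSpace X] (f : X → X) (x : X) : Prop :=
  Dense {y : X | ∃ n : ℕ, 1 ≤ n ∧ f^[n] x = y}

/-- Topological transitivity. -/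
def TopTransitive {X : Type*} [TopologicalSpace X] (f : X → X) : Prop :=
  ∀ U V : Set X, IsOpen U → IsOpen V → U.Nonempty → V.Nonempty →
    ∃ n : ℕ, 0 < n ∧ (f^[n] '' U ∩ V).Nonempty

/-- Total transitivity: every iterate is transitive. -/
def TotallyTransitive {X : Type*} [TopologicalSpace X] (f : X → X) : Prop :=
  ∀ n : ℕ, 1 ≤ n → TopTransitive (f^[n])

/-- Weak mixing: `f × f` is transitive. -/
def WeaklyMixing {X : Type*} [TopologicalSpace X] (f : X → X) : Prop :=
  TopTransitive (Prod.map f f)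

/-- Topological mixing. -/
def TopMixing {X : Type*} [TopologicalSpace X] (f : X → X) : Prop :=
  ∀ U V : Set X, IsOpen U → IsOpen V → U.Nonempty → V.Nonempty →
    ∃ N : ℕ, ∀ n, N ≤ n → (f^[n] '' U ∩ V).Nonempty

/-- Exactness. -/
def TopExact {X : Type*} [TopologicalSpace X] (f : X → X) : Prop :=
  ∀ U : Set X, IsOpen U → U.Nonempty → ∃ N : ℕ, 0 < N ∧ f^[N] '' U = Set.univ

/-- `A` is an arc with endpoints `a` and `b`. -/
def IsArcEnds {X : Type*} [TopologicalSpace X] (A : Set X) (a b : X) : Prop :=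
  ∃ e : (Set.Icc (0:ℝ) 1) ≃ₜ A,
    (e ⟨0, by norm_num⟩ : X) = a ∧ (e ⟨1, by norm_num⟩ : X) = b

/-- `A` is a free arc with endpoints `a` and `b`. -/
def IsFreeArc {X : Type*} [TopologicalSpace X] (A : Set X) (a b : X) : Prop :=
  IsArcEnds A a b ∧ IsOpen (A \ {a, b})

/-- A regular periodic decomposition of length `m` for `f`. -/
def IsRegPerDecomp {X : Type*} [TopologicalSpace X] (f : X → X) (m : ℕ)
    (Ds : ZMod m → Set X) : Prop :=
  0 < m ∧ (∀ i, Ds i = closure (interior (Ds i))) ∧ (⋃ i, Ds i) = Set.univ ∧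
    (∀ i, f '' Ds i = Ds (i + 1)) ∧ (∀ i j, i ≠ j → IsNowhereDense (Ds i ∩ Ds j))

/-- `f` admits a terminal (maximal-length) regular periodic decomposition. -/
def HasTerminalDecomp {X : Type*} [TopologicalSpace X] (f : X → X) : Prop :=
  ∃ (m : ℕ) (Ds : ZMod m → Set X), IsRegPerDecomp f m Ds ∧
    ∀ (m' : ℕ) (Ds' : ZMod m' → Set X), IsRegPerDecomp f m' Ds' → m' ≤ m

/-- The induced map on the hyperspace of nonempty closed (= compact) subsets. -/
def hyperMap {X : Type*} [TopologicalSpace X] {f : X → X} (hf : Continuous f) :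
    NonemptyCompacts X → NonemptyCompacts X :=
  fun A => ⟨⟨f '' A, A.isCompact.image hf⟩, A.nonempty.image f⟩

/-- The set of connected components of `X \ {p}`. -/
def componentsAt (X : Type*) [TopologicalSpace X] (p : X) : Set (Set X) :=
  {C | ∃ x : X, x ≠ p ∧ C = connectedComponentIn ({p}ᶜ : Set X) x}

section BoundaryBumping

variable {X : Type*} [TopologicalSpace X] [CompactSpace X] [T2Space X]

/-- In a closed set `K`, a component contained in an open set `O` is contained in a relatively
clopen subset of `K` that is contained in `O`. -/
theorem exists_relClopen_of_connectedComponentIn_subset {K O : Set X} (hK : IsClosed K)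
    (hO : IsOpen O) {x : X} (hx : x ∈ K) (h : connectedComponentIn K x ⊆ O) :
    ∃ S ⊆ K, x ∈ S ∧ S ⊆ O ∧ IsClosed S ∧ IsClosed (K \ S) := by
  have : CompactSpace K := isCompact_iff_compactSpace.1 hK.isCompact
  have hne : Nonempty {s : Set K // IsClopen s ∧ (⟨x, hx⟩ : K) ∈ s} :=
    ⟨⟨univ, isClopen_univ, mem_univ _⟩⟩
  obtain ⟨⟨s, hs, hxs⟩, hsO⟩ := exists_subset_nhds_of_isCompact
    (V := fun s : {s : Set K // IsClopen s ∧ (⟨x, hx⟩ : K) ∈ s} => (s : Set K))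
    (U := Subtype.val ⁻¹' O)
    (fun s t => ⟨⟨s.1 ∩ t.1, s.2.1.inter t.2.1, s.2.2, t.2.2⟩, inter_subset_left,
      inter_subset_right⟩)
    (fun s => s.2.1.1.isCompact)
    (fun y hy => by
      rw [← connectedComponent_eq_iInter_isClopen] at hy
      refine (hO.preimage continuous_subtype_val).mem_nhds (h ?_)
      rw [connectedComponentIn_eq_image hx]
      exact mem_image_of_mem _ hy)
  refine ⟨Subtype.val '' s, Subtype.coe_image_subset K s, ⟨_, hxs, rfl⟩,
    image_subset_iff.2 hsO, hK.isClosedMap_subtype_val _ hs.1, ?_⟩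
  have : K \ Subtype.val '' s = Subtype.val '' sᶜ := by
    ext y
    simp only [Set.mem_sdiff, mem_image, Subtype.exists, mem_compl_iff, exists_and_right,
      exists_eq_right]
    grind
  rw [this]
  exact hK.isClosedMap_subtype_val _ hs.compl.1

/-- Boundary bumping for closed sets. -/
theorem exists_mem_connectedComponentIn_notMem_interior [PreconnectedSpace X] {K : Set X}
    (hK : IsClosed K) (hne : K ≠ univ) {x : X} (hx : x ∈ K) :
    ∃ y ∈ connectedComponentIn K x, y ∉ interior K := by
  by_contra! h
  obtain ⟨S, hSK, hxS, hSO, hS, hKS⟩ :=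
    exists_relClopen_of_connectedComponentIn_subset hK isOpen_interior hx h
  have hSo : IsOpen S := by
    rw [← isClosed_compl_iff]
    have : Sᶜ = (K \ S) ∪ (interior K)ᶜ := by
      ext y
      have h₁ : y ∈ S → y ∈ interior K := fun h => hSO h
      have h₂ : y ∈ interior K → y ∈ K := fun h => interior_subset h
      simp only [mem_compl_iff, mem_union, Set.mem_sdiff]
      tauto
    rw [this]
    exact hKS.union isOpen_interior.isClosed_compl
  rcases isClopen_iff.1 ⟨hS, hSo⟩ with h | h
  · simp [h] at hxS
  · exact hne (univ_subset_iff.1 (h ▸ hSK))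

/-- Boundary bumping for the complement of a point. -/
theorem mem_closure_connectedComponentIn_compl_singleton [PreconnectedSpace X] {x z : X}
    (hxz : x ≠ z) : z ∈ closure (connectedComponentIn {z}ᶜ x) := by
  by_contra hz
  obtain ⟨O, hO, hzO, hd⟩ : ∃ O, IsOpen O ∧ z ∈ O ∧
      Disjoint (closure O) (connectedComponentIn {z}ᶜ x) := by
    obtain ⟨U, V, hU, hV, hzU, hV', hUV⟩ := SeparatedNhds.of_isCompact_isClosed
      (isCompact_singleton (x := z)) (isClosed_closure (s := connectedComponentIn {z}ᶜ x))
      (by simpa using hz)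
    exact ⟨U, hU, hzU rfl, (hUV.closure_left hV).mono_right (subset_closure.trans hV')⟩
  have hPO : connectedComponentIn {z}ᶜ x ⊆ interior Oᶜ := by
    rw [interior_compl]
    exact hd.subset_compl_left
  have hx : x ∈ connectedComponentIn {z}ᶜ x := mem_connectedComponentIn hxz
  obtain ⟨y, hy, hyO⟩ := exists_mem_connectedComponentIn_notMem_interior hO.isClosed_compl
    (fun h => by simpa [h] using (show z ∉ Oᶜ from fun h => h hzO)) (interior_subset (hPO hx))
  exact hyO (hPO (connectedComponentIn_mono x
    (compl_subset_compl.2 (singleton_subset_iff.2 hzO)) hy))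

end BoundaryBumping

/-- The component of a point in a closed set is closed. -/
theorem isClosed_connectedComponentIn {X : Type*} [TopologicalSpace X] {K : Set X}
    (hK : IsClosed K) (x : X) : IsClosed (connectedComponentIn K x) := by
  by_cases hx : x ∈ K
  · rw [connectedComponentIn_eq_image hx]
    exact hK.isClosedMap_subtype_val _ isClosed_connectedComponent
  · rw [connectedComponentIn_eq_empty hx]
    exact isClosed_empty

/-- Two points of a connected subset of `F` lie in the same component of `F`. -/
theorem connectedComponentIn_eq_of_isPreconnected {X : Type*} [TopologicalSpace X]
    {s F : Set X} (hs : IsPreconnected s) (hsF : s ⊆ F) {x y : X} (hx : x ∈ s) (hy : y ∈ s) :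
    connectedComponentIn F x = connectedComponentIn F y :=
  connectedComponentIn_eq (hs.subset_connectedComponentIn hx hsF hy)

/-- Dendrites are connected im kleinen. -/
theorem IsDendrite.connectedComponentIn_mem_nhds_of_isClosed {X : Type*} [TopologicalSpace X]
    [CompactSpace X] [T2Space X] [ConnectedSpace X] (hX : IsDendrite X) {V : Set X}
    (hV : IsClosed V) {x : X} (hxV : V ∈ 𝓝 x) : connectedComponentIn V x ∈ 𝓝 x := by
  set C := connectedComponentIn V x with hC
  have hxC : x ∈ C := mem_connectedComponentIn (mem_of_mem_nhds hxV)
  by_contra hCx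
  have hVne : V ≠ univ := by
    rintro rfl
    refine hCx ?_
    rw [hC, connectedComponentIn_univ, PreconnectedSpace.connectedComponent_eq_univ]
    exact univ_mem
  have hNe : (𝓝[Cᶜ] x).NeBot := by
    rw [← mem_closure_iff_nhdsWithin_neBot, closure_compl, mem_compl_iff,
      mem_interior_iff_mem_nhds]
    exact hCx
  obtain ⟨U, hU⟩ := Ultrafilter.exists_le (𝓝[Cᶜ] x)
  have hUx : (U : Filter X) ≤ 𝓝 x := hU.trans nhdsWithin_le_nhds
  have hUC : ∀ᶠ a in U, a ∉ C := hU self_mem_nhdsWithin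
  have hUV : ∀ᶠ a in U, a ∈ V := hUx hxV
  have hbump : ∀ a, ∃ b, a ∈ V → b ∈ connectedComponentIn V a ∧ b ∉ interior V := fun a => by
    by_cases ha : a ∈ V
    · obtain ⟨b, hb⟩ := exists_mem_connectedComponentIn_notMem_interior hV hVne ha
      exact ⟨b, fun _ => hb⟩
    · exact ⟨a, fun h => absurd h ha⟩
  choose g hg using hbump
  obtain ⟨y, -, hy⟩ := isCompact_univ.ultrafilter_le_nhds (U.map g) (by simp)
  have hgy : Tendsto g U (𝓝 y) := hy
  have hyV : y ∈ V := hV.mem_of_tendsto hgy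
    (hUV.mono fun a ha => connectedComponentIn_subset _ _ (hg a ha).1)
  have hxy : x ≠ y := by
    rintro rfl
    have : x ∈ (interior V)ᶜ := isOpen_interior.isClosed_compl.mem_of_tendsto hgy
      (hUV.mono fun a ha => (hg a ha).2)
    exact this (mem_interior_iff_mem_nhds.2 hxV)
  have hyC : y ∈ C := by
    by_contra hyC
    obtain ⟨S, hSV, hxS, hSy, hS, hVS⟩ := exists_relClopen_of_connectedComponentIn_subset hV
      (O := {y}ᶜ) isOpen_compl_singleton (mem_of_mem_nhds hxV)
      (subset_compl_singleton_iff.2 hyC)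
    have hUS : ∀ᶠ a in U, a ∈ S := by
      filter_upwards [hUV, hUx (hVS.isOpen_compl.mem_nhds (fun h => h.2 hxS))] with a h₁ h₂
      by_contra h
      exact h₂ ⟨h₁, h⟩
    refine hSy (hS.mem_of_tendsto hgy ?_) rfl
    filter_upwards [hUV, hUS] with a ha haS
    by_contra hgS
    obtain ⟨b, -, hb, hb'⟩ := (isPreconnected_closed_iff.1 isPreconnected_connectedComponentIn)
      S (V \ S) hS hVS ((connectedComponentIn_subset V a).trans (by simp))
      ⟨a, mem_connectedComponentIn ha, haS⟩
      ⟨g a, (hg a ha).1, connectedComponentIn_subset _ _ (hg a ha).1, hgS⟩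
    exact hb'.2 hb
  obtain ⟨z, hzx, hzy, hz⟩ := hX.2 x y hxy
  have hzC : z ∈ C := by
    by_contra h
    exact hz (connectedComponentIn_eq_of_isPreconnected isPreconnected_connectedComponentIn
      (subset_compl_singleton_iff.2 h) hxC hyC)
  have hsub : ∀ a, a ∈ V → a ∉ C → connectedComponentIn V a ⊆ {z}ᶜ := by
    rintro a ha haC _ hb rfl
    exact haC (hC ▸ connectedComponentIn_eq hzC ▸ connectedComponentIn_eq hb ▸
      mem_connectedComponentIn ha)
  have hcase : ∀ w, ∀ᶠ a in U, a ∉ connectedComponentIn {z}ᶜ w := by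
    intro w
    rw [Ultrafilter.eventually_not]
    intro hw
    have hxP : x ∈ closure (connectedComponentIn {z}ᶜ w) :=
      mem_closure_of_tendsto (f := id) hUx hw
    have hyP : y ∈ closure (connectedComponentIn {z}ᶜ w) := by
      refine mem_closure_of_tendsto hgy ?_
      filter_upwards [hw, hUV, hUC] with a h₁ h₂ h₃
      rw [connectedComponentIn_eq h₁]
      exact isPreconnected_connectedComponentIn.subset_connectedComponentIn
        (mem_connectedComponentIn h₂) (hsub a h₂ h₃) (hg a h₂).1
    refine hz (connectedComponentIn_eq_of_isPreconnected
      (s := insert x (insert y (connectedComponentIn {z}ᶜ w)))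
      (isPreconnected_connectedComponentIn.subset_closure
        ((subset_insert _ _).trans (subset_insert _ _))
        (insert_subset hxP (insert_subset hyP subset_closure)))
      (insert_subset hzx.symm (insert_subset hzy.symm (connectedComponentIn_subset _ _)))
      (by simp) (by simp))
  obtain ⟨z', hz'x, hz'z, hz'⟩ := hX.2 x z hzx.symm
  set W : Set X := ⋃₀ {s | ∃ a, a ≠ z ∧ a ∉ connectedComponentIn {z}ᶜ z' ∧
    s = insert z (connectedComponentIn {z}ᶜ a)}
  have hWc : IsPreconnected W := by
    refine isPreconnected_sUnion z _ ?_ ?_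
    · rintro _ ⟨a, -, -, rfl⟩
      exact mem_insert _ _
    · rintro _ ⟨a, ha, -, rfl⟩
      exact isPreconnected_connectedComponentIn.subset_closure (subset_insert _ _)
        (insert_subset (mem_closure_connectedComponentIn_compl_singleton ha) subset_closure)
  have hUz : ∀ᶠ a in U, a ≠ z := hUx (isOpen_compl_singleton.mem_nhds hzx.symm)
  have hUW : ∀ᶠ a in U, a ∈ W ∧ z ∈ W := by
    filter_upwards [hUz, hcase z'] with a h₁ h₂
    exact ⟨⟨_, ⟨a, h₁, h₂, rfl⟩, mem_insert_of_mem _ (mem_connectedComponentIn h₁)⟩,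
      ⟨_, ⟨a, h₁, h₂, rfl⟩, mem_insert _ _⟩⟩
  have hzW : z ∈ W := hUW.exists.choose_spec.2
  have hxW : x ∈ closure W := mem_closure_of_tendsto (f := id) hUx (hUW.mono fun a h => h.1)
  have hz'W : z' ∉ W := by
    rintro ⟨_, ⟨a, ha, ha', rfl⟩, rfl | h⟩
    · exact hz'z rfl
    · exact ha' (connectedComponentIn_eq h ▸ mem_connectedComponentIn ha)
  exact hz' (connectedComponentIn_eq_of_isPreconnected (s := insert x W)
    (hWc.subset_closure (subset_insert _ _) (insert_subset hxW subset_closure))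
    (insert_subset hz'x.symm (subset_compl_singleton_iff.2 hz'W))
    (mem_insert _ _) (mem_insert_of_mem _ hzW))

/-- Dendrites are locally connected. -/
theorem IsDendrite.locallyConnectedSpace {X : Type*} [TopologicalSpace X]
    [CompactSpace X] [T2Space X] [ConnectedSpace X] (hX : IsDendrite X) :
    LocallyConnectedSpace X := by
  refine locallyConnectedSpace_iff_connected_subsets.2 fun x U hU => ?_
  obtain ⟨V, ⟨hVx, hV⟩, hVU⟩ := (closed_nhds_basis x).mem_iff.1 hU
  exact ⟨_, hX.connectedComponentIn_mem_nhds_of_isClosed hV hVx,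
    isPreconnected_connectedComponentIn, (connectedComponentIn_subset _ _).trans hVU⟩

section RegularPeriodicDecomposition

variable {X : Type*} [TopologicalSpace X] {f : X → X}

namespace IsRegPerDecomp

variable {m : ℕ} {Ds : ZMod m → Set X}

theorem isClosed (h : IsRegPerDecomp f m Ds) (i : ZMod m) : IsClosed (Ds i) := by
  rw [h.2.1 i]
  exact isClosed_closure

theorem eq_of_inter_interior_nonempty (h : IsRegPerDecomp f m Ds) {i j : ZMod m}
    (hij : (Ds j ∩ interior (Ds i)).Nonempty) : j = i := by
  by_contra hne
  obtain ⟨x, hxj, hxi⟩ := hij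
  rw [h.2.1 j] at hxj
  obtain ⟨y, hyi, hyj⟩ := mem_closure_iff.1 hxj _ isOpen_interior hxi
  have hnd : interior (closure (Ds j ∩ Ds i)) = ∅ := h.2.2.2.2 j i hne
  rw [← mem_empty_iff_false y, ← hnd]
  refine interior_mono subset_closure ?_
  rw [interior_inter]
  exact ⟨hyj, hyi⟩

theorem image_iterate (h : IsRegPerDecomp f m Ds) (n : ℕ) (i : ZMod m) :
    f^[n] '' Ds i = Ds (i + n) := by
  induction n with
  | zero => simp
  | succ n ih =>
    rw [Function.iterate_succ', image_comp, ih, h.2.2.2.1]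
    push_cast
    rw [add_assoc]

theorem nonempty [Nonempty X] (h : IsRegPerDecomp f m Ds) (i : ZMod m) : (Ds i).Nonempty := by
  have : NeZero m := ⟨h.1.ne'⟩
  obtain ⟨x⟩ := ‹Nonempty X›
  obtain ⟨j, hj⟩ := mem_iUnion.1 (h.2.2.1.symm ▸ mem_univ x)
  have := h.image_iterate (i - j).val j
  rw [ZMod.natCast_zmod_val, add_sub_cancel] at this
  exact this ▸ (Set.Nonempty.image _ ⟨x, hj⟩)

/-- If `q` lies in only one member `Ds i` of a connected regular periodic decomposition, then one
side of any separation of the complement of `q` is contained in `Ds i`. -/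
theorem subset_of_separation [PreconnectedSpace X] [Nonempty X] (h : IsRegPerDecomp f m Ds)
    (hconn : ∀ i, IsConnected (Ds i)) {q : X} {i : ZMod m} (hq : ∀ j, q ∈ Ds j → j = i)
    {A B : Set X} (hA : IsOpen A) (hB : IsOpen B) (hcover : {q}ᶜ ⊆ A ∪ B) (hd : Disjoint A B) :
    A ⊆ Ds i ∨ B ⊆ Ds i := by
  have : NeZero m := ⟨h.1.ne'⟩
  let G : SimpleGraph (ZMod m) :=
    { Adj := fun a b => a ≠ b ∧ (Ds a ∩ Ds b).Nonempty
      symm := ⟨fun a b hab => ⟨hab.1.symm, inter_comm (Ds a) (Ds b) ▸ hab.2⟩⟩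
      loopless := ⟨fun a ha => ha.1 rfl⟩ }
  have hG : G.Connected := by
    refine ⟨fun a b => ?_⟩
    set R : Set X := ⋃ j ∈ {j | G.Reachable a j}, Ds j
    set R' : Set X := ⋃ j ∈ {j | ¬ G.Reachable a j}, Ds j
    have hR : IsClosed R := (Set.toFinite _).isClosed_biUnion fun j _ => h.isClosed j
    have hR' : IsClosed R' := (Set.toFinite _).isClosed_biUnion fun j _ => h.isClosed j
    have hRR' : Disjoint R R' := by
      rw [Set.disjoint_left]
      intro x hx hx'
      obtain ⟨j, hj, hxj⟩ := mem_iUnion₂.1 hx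
      obtain ⟨k, hk, hxk⟩ := mem_iUnion₂.1 hx'
      have hjk : j ≠ k := by
        rintro rfl
        exact hk hj
      exact hk (SimpleGraph.Reachable.trans hj
        (SimpleGraph.Adj.reachable ⟨hjk, x, hxj, hxk⟩))
    have hcompl : R' = Rᶜ := by
      refine Subset.antisymm hRR'.subset_compl_left fun x hx => ?_
      obtain ⟨j, hj⟩ := mem_iUnion.1 (h.2.2.1.symm ▸ mem_univ x)
      exact mem_iUnion₂.2 ⟨j, fun hr => hx (mem_iUnion₂.2 ⟨j, hr, hj⟩), hj⟩
    rcases isClopen_iff.1 (⟨hR, isClosed_compl_iff.1 (hcompl ▸ hR')⟩ : IsClopen R) with h0 | h1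
    · obtain ⟨x, hx⟩ := h.nonempty a
      have : x ∈ R := mem_iUnion₂.2 ⟨a, SimpleGraph.Reachable.refl a, hx⟩
      simp [h0] at this
    · by_contra hb
      obtain ⟨x, hx⟩ := h.nonempty b
      have : x ∈ R' := mem_iUnion₂.2 ⟨b, hb, hx⟩
      simp [hcompl, h1] at this
  obtain ⟨v, hv⟩ := hG.exists_preconnected_induce_compl_singleton_of_finite
  have hside : ∀ j, j ≠ i → Ds j ⊆ A ∨ Ds j ⊆ B := fun j hj =>
    (hconn j).isPreconnected.subset_or_subset hA hB hd fun x hx =>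
      hcover fun hxq => hj (hq j (mem_singleton_iff.1 hxq ▸ hx))
  have hadj : ∀ a b, (Ds a ∩ Ds b).Nonempty → (Ds (a + (i - v)) ∩ Ds (b + (i - v))).Nonempty := by
    rintro a b ⟨x, hxa, hxb⟩
    have ha := h.image_iterate (i - v).val a
    have hb := h.image_iterate (i - v).val b
    rw [ZMod.natCast_zmod_val] at ha hb
    exact ⟨f^[(i - v).val] x, ha ▸ mem_image_of_mem _ hxa, hb ▸ mem_image_of_mem _ hxb⟩
  have hshift : ∀ a : ({v}ᶜ : Set (ZMod m)), (a : ZMod m) + (i - v) ≠ i := fun a ha =>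
    a.2 (by rw [mem_singleton_iff]; linear_combination ha)
  have hstep : ∀ a b : ({v}ᶜ : Set (ZMod m)), (G.induce {v}ᶜ).Reachable a b →
      Ds (a + (i - v)) ⊆ A → Ds (b + (i - v)) ⊆ A := by
    rintro a b ⟨p⟩
    induction p with
    | nil => exact id
    | cons hab _ ih =>
      intro ha
      refine ih ((hside _ (hshift _)).resolve_right fun hb => ?_)
      obtain ⟨x, hx, hx'⟩ := hadj _ _ hab.2
      exact Set.disjoint_left.1 hd (ha hx) (hb hx')
  have hmem : ∀ j, j ≠ i → ∃ a : ({v}ᶜ : Set (ZMod m)), (a : ZMod m) + (i - v) = j := fun j hj =>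
    ⟨⟨j - (i - v), fun hjv => hj (by rw [mem_singleton_iff] at hjv; linear_combination hjv)⟩,
      sub_add_cancel _ _⟩
  have hdisj : ∀ S T : Set X, Disjoint S T → (∀ j, j ≠ i → Ds j ⊆ S) → T ⊆ Ds i := by
    intro S T hST hS x hx
    obtain ⟨j, hj⟩ := mem_iUnion.1 (h.2.2.1.symm ▸ mem_univ x)
    by_cases hji : j = i
    · exact hji ▸ hj
    · exact absurd hx (Set.disjoint_left.1 hST (hS j hji hj))
  by_cases hex : ∃ j, j ≠ i ∧ Ds j ⊆ A
  · obtain ⟨j, hj, hjA⟩ := hex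
    refine Or.inr (hdisj A B hd fun k hk => ?_)
    obtain ⟨a, rfl⟩ := hmem j hj
    obtain ⟨b, rfl⟩ := hmem k hk
    exact hstep a b (hv a b) hjA
  · push Not at hex
    exact Or.inl (hdisj B A hd.symm fun k hk => (hside k hk).resolve_left (hex k hk))

end IsRegPerDecomp

/-- A forward-invariant closed set with nonempty interior is everything. -/
theorem TopTransitive.eq_univ_of_image_subset (ht : TopTransitive f) {S U : Set X}
    (hS : IsClosed S) (hU : IsOpen U) (hUne : U.Nonempty) (hUS : U ⊆ S) (hfS : f '' S ⊆ S) :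
    S = univ := by
  by_contra hne
  obtain ⟨n, -, _, ⟨x, hx, rfl⟩, hxV⟩ :=
    ht U Sᶜ hU hS.isOpen_compl hUne (nonempty_compl.2 hne)
  exact hxV ((mapsTo_iff_image_subset.2 hfS).iterate n (hUS hx))

theorem TopTransitive.surjective [CompactSpace X] [T2Space X] (hf : Continuous f)
    (ht : TopTransitive f) : Function.Surjective f := by
  rw [← range_eq_univ]
  by_contra hne
  have hV := nonempty_compl.2 hne
  obtain ⟨n, hn, _, ⟨x, -, rfl⟩, hx⟩ := ht univ (range f)ᶜ isOpen_univ
    (isCompact_range hf).isClosed.isOpen_compl ⟨hV.some, trivial⟩ hV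
  obtain ⟨k, rfl⟩ := Nat.exists_eq_succ_of_ne_zero hn.ne'
  exact hx ⟨f^[k] x, (Function.iterate_succ_apply' f k x).symm⟩

/-- Without a terminal decomposition, decompositions are arbitrarily long. -/
theorem exists_isRegPerDecomp_lt_length (hsurj : Function.Surjective f)
    (hterm : ¬ HasTerminalDecomp f) (N : ℕ) :
    ∃ (m : ℕ) (Ds : ZMod m → Set X), N < m ∧ IsRegPerDecomp f m Ds := by
  induction N with
  | zero =>
    refine ⟨1, fun _ => univ, one_pos, one_pos, by simp, by simp [iUnion_const], fun _ => ?_, ?_⟩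
    · rw [image_univ, hsurj.range_eq]
    · exact fun i j hij => absurd (Subsingleton.elim (α := Fin 1) i j) hij
  | succ N ih =>
    obtain ⟨m, Ds, hm, h⟩ := ih
    by_contra! hno
    exact hterm ⟨m, Ds, h, fun m' Ds' h' => by
      by_contra! hlt
      exact hno m' Ds' (by omega) h'⟩

/-- On a locally connected compact Hausdorff space every regular periodic decomposition of a
transitive map gives rise to a connected one that is at least as long. -/
theorem IsRegPerDecomp.exists_connected [CompactSpace X] [T2Space X] [LocallyConnectedSpace X]
    [Nonempty X] (hf : Continuous f) (ht : TopTransitive f) {m : ℕ} {Ds : ZMod m → Set X}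
    (h : IsRegPerDecomp f m Ds) :
    ∃ (l : ℕ) (Es : ZMod l → Set X), m ≤ l ∧ IsRegPerDecomp f l Es ∧
      ∀ i, IsConnected (Es i) := by
  obtain ⟨x, hx⟩ : (interior (Ds 0)).Nonempty := by
    have := h.nonempty 0
    rw [h.2.1 0] at this
    exact closure_nonempty_iff.1 this
  set C := connectedComponentIn (interior (Ds 0)) x
  have hCo : IsOpen C := isOpen_interior.connectedComponentIn
  have hxC : x ∈ C := mem_connectedComponentIn hx
  have hxD : x ∈ Ds 0 := interior_subset hx
  set K := connectedComponentIn (Ds 0) x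
  have hCK : C ⊆ K := connectedComponentIn_mono x interior_subset
  have hKD : K ⊆ Ds 0 := connectedComponentIn_subset _ _
  have hKconn : IsConnected K := isConnected_connectedComponentIn_iff.2 hxD
  have hKclosed : IsClosed K := isClosed_connectedComponentIn (h.isClosed 0) x
  set E : ℕ → Set X := fun n => f^[n] '' K with hE
  have hEadd : ∀ a b, f^[a] '' E b = E (a + b) := fun a b => by
    simp only [hE, Function.iterate_add, image_comp]
  have hE0 : E 0 = K := by simp [hE]
  have hEconn : ∀ n, IsConnected (E n) := fun n => hKconn.image _ (hf.iterate n).continuousOn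
  have hEclosed : ∀ n, IsClosed (E n) := fun n =>
    (hKclosed.isCompact.image (hf.iterate n)).isClosed
  have hED : ∀ n, E n ⊆ Ds n := fun n => by
    have := h.image_iterate n 0
    rw [zero_add] at this
    exact this ▸ image_mono hKD
  have hEK : ∀ n : ℕ, (n : ZMod m) = 0 → (E n ∩ K).Nonempty → E n ⊆ K := fun n hn ⟨y, hy, hyK⟩ => by
    have : E n ⊆ Ds 0 := hn ▸ hED n
    rw [show K = connectedComponentIn (Ds 0) y from connectedComponentIn_eq hyK]
    exact (hEconn n).isPreconnected.subset_connectedComponentIn hy this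
  have hex : ∃ n : ℕ, 0 < n ∧ (n : ZMod m) = 0 ∧ (E n ∩ K).Nonempty := by
    obtain ⟨n, hn, y, hyE, hyC⟩ := ht C C hCo hCo ⟨x, hxC⟩ ⟨x, hxC⟩
    have hyE' : y ∈ E n := image_mono hCK hyE
    exact ⟨n, hn, h.eq_of_inter_interior_nonempty
      ⟨y, hED n hyE', connectedComponentIn_subset _ _ hyC⟩, y, hyE', hCK hyC⟩
  classical
  set l := Nat.find hex
  obtain ⟨hl, hlm, hlK⟩ : 0 < l ∧ (l : ZMod m) = 0 ∧ (E l ∩ K).Nonempty := Nat.find_spec hex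
  have hmin : ∀ n : ℕ, 0 < n → n < l → (n : ZMod m) = 0 → Disjoint (E n) K := fun n hn hnl hn0 => by
    have := Nat.find_min hex hnl
    rw [← not_nonempty_iff_eq_empty.trans disjoint_iff_inter_eq_empty.symm]
    exact fun h' => this ⟨hn, hn0, h'⟩
  have hElK : E l ⊆ K := hEK l hlm hlK
  have hEl : ∀ n, E (l + n) ⊆ E n := fun n => by
    rw [add_comm, ← hEadd]
    exact image_mono hElK
  have hdisj' : ∀ i j : ℕ, i < j → j < l → (i : ZMod m) = j → Disjoint (E i) (E j) := by
    intro i j hij hjl hmod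
    rw [Set.disjoint_left]
    intro y hyi hyj
    have h₁ : f^[l - i] y ∈ K := hElK (by
      have := mem_image_of_mem f^[l - i] hyi
      rwa [hEadd, Nat.sub_add_cancel (hij.trans hjl).le] at this)
    have h₂ : f^[l - i] y ∈ E (j - i) := hEl _ (by
      have := mem_image_of_mem f^[l - i] hyj
      rwa [hEadd, show l - i + j = l + (j - i) by omega] at this)
    refine Set.disjoint_left.1 (hmin (j - i) (by omega) (by omega) ?_) h₂ h₁
    rw [Nat.cast_sub hij.le, hmod, sub_self]
  have hdisj : ∀ i j : ℕ, i ≠ j → i < l → j < l → (i : ZMod m) = j → Disjoint (E i) (E j) := by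
    intro i j hij hi hj hmod
    rcases hij.lt_or_gt with hlt | hlt
    · exact hdisj' i j hlt hj hmod
    · exact (hdisj' j i hlt hi hmod.symm).symm
  have hclosedU : ∀ P : ℕ → Prop, IsClosed (⋃ j ∈ {j | j < l ∧ P j}, E j) := fun P =>
    ((Set.finite_lt_nat l).subset fun j hj => hj.1).isClosed_biUnion fun j _ => hEclosed j
  have hcover : ∀ y, ∃ j < l, y ∈ E j := by
    have huniv := ht.eq_univ_of_image_subset (S := ⋃ j ∈ {j | j < l ∧ True}, E j) (hclosedU _) hCo
      ⟨x, hxC⟩ (fun y hy => mem_iUnion₂.2 ⟨0, ⟨hl, trivial⟩, hE0 ▸ hCK hy⟩) (by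
        rintro _ ⟨y, hy, rfl⟩
        obtain ⟨j, ⟨hj, -⟩, hyj⟩ := mem_iUnion₂.1 hy
        have hfy : f y ∈ E (1 + j) := hEadd 1 j ▸ mem_image_of_mem _ hyj
        rcases Nat.lt_or_ge (1 + j) l with hlt | hge
        · exact mem_iUnion₂.2 ⟨1 + j, ⟨hlt, trivial⟩, hfy⟩
        · have : 1 + j = l := by omega
          exact mem_iUnion₂.2 ⟨0, ⟨hl, trivial⟩, hE0 ▸ hElK (this ▸ hfy)⟩)
    intro y
    obtain ⟨j, ⟨hj, -⟩, hyj⟩ := mem_iUnion₂.1 (huniv.symm ▸ mem_univ y)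
    exact ⟨j, hj, hyj⟩
  have hDcover : ∀ r, ∀ y ∈ Ds r, ∃ j < l, (j : ZMod m) = r ∧ y ∈ E j := by
    intro r y hy
    have hsub : Ds r ⊆ ⋃ j ∈ {j : ℕ | j < l ∧ (j : ZMod m) = r}, E j := by
      rw [h.2.1 r]
      refine closure_minimal (fun w hw => ?_) (hclosedU _)
      obtain ⟨j, hj, hwj⟩ := hcover w
      exact mem_iUnion₂.2 ⟨j, ⟨hj, h.eq_of_inter_interior_nonempty ⟨w, hED j hwj, hw⟩⟩, hwj⟩
    obtain ⟨j, ⟨hj, hjr⟩, hyj⟩ := mem_iUnion₂.1 (hsub hy)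
    exact ⟨j, hj, hjr, hyj⟩
  have hEl_eq : E l = K := by
    refine hElK.antisymm fun y hy => ?_
    have hD := h.image_iterate l 0
    rw [hlm, add_zero] at hD
    obtain ⟨w, hw, rfl⟩ := hD.symm ▸ hKD hy
    obtain ⟨j, hj, hj0, hwj⟩ := hDcover 0 w hw
    rcases Nat.eq_zero_or_pos j with rfl | hjpos
    · exact mem_image_of_mem _ (hE0 ▸ hwj)
    · exact absurd hy (Set.disjoint_left.1 (hmin j hjpos hj hj0)
        (hEl j (hEadd l j ▸ mem_image_of_mem _ hwj)))
  have hreg : ∀ j < l, E j = closure (interior (E j)) := by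
    intro j hj
    refine Subset.antisymm (fun y hy => ?_) (closure_minimal interior_subset (hEclosed j))
    set F : Set X := ⋃ k ∈ {k : ℕ | k < l ∧ ((k : ZMod m) = j ∧ k ≠ j)}, E k
    have hyF : y ∉ F := fun hyF => by
      obtain ⟨k, ⟨hk, hkj, hne⟩, hyk⟩ := mem_iUnion₂.1 hyF
      exact Set.disjoint_left.1 (hdisj k j hne hk hj hkj) hyk hy
    have hFo : IsOpen Fᶜ := (hclosedU _).isOpen_compl
    have hyD : y ∈ closure (interior (Ds j)) := h.2.1 j ▸ hED j hy
    refine closure_mono (interior_maximal ?_ (hFo.inter isOpen_interior))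
      (hFo.inter_closure ⟨hyF, hyD⟩)
    rintro w ⟨hwF, hwD⟩
    obtain ⟨k, hk, hkj, hwk⟩ := hDcover j w (interior_subset hwD)
    by_cases hne : k = j
    · exact hne ▸ hwk
    · exact absurd (mem_iUnion₂.2 ⟨k, ⟨hk, hkj, hne⟩, hwk⟩) hwF
  have : NeZero l := ⟨hl.ne'⟩
  refine ⟨l, fun i => E i.val, Nat.le_of_dvd hl ((ZMod.natCast_eq_zero_iff l m).1 hlm),
    ⟨hl, fun i => hreg _ i.val_lt, ?_, ?_, ?_⟩, fun i => hEconn _⟩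
  · refine eq_univ_of_forall fun y => ?_
    obtain ⟨j, hj, hyj⟩ := hcover y
    exact mem_iUnion.2 ⟨j, by rwa [ZMod.val_cast_of_lt hj]⟩
  · intro i
    have h₁ : f '' E i.val = E (1 + i.val) := hEadd 1 i.val
    change f '' E i.val = E (i + 1).val
    rw [h₁]
    rcases Nat.lt_or_ge (1 + i.val) l with hlt | hge
    · have : i + 1 = ((1 + i.val : ℕ) : ZMod l) := by
        push_cast
        rw [ZMod.natCast_zmod_val, add_comm]
      rw [this, ZMod.val_cast_of_lt hlt]
    · have hval : 1 + i.val = l := by have := i.val_lt; omega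
      have : i + 1 = 0 := by
        have := congrArg (Nat.cast : ℕ → ZMod l) hval
        push_cast at this
        rwa [ZMod.natCast_zmod_val, ZMod.natCast_self, add_comm] at this
      rw [this, hval, ZMod.val_zero, hEl_eq, hE0]
  · intro i j hij
    by_cases hmod : (i.val : ZMod m) = j.val
    · rw [(hdisj _ _ (fun h => hij (ZMod.val_injective l h)) i.val_lt j.val_lt hmod).inter_eq]
      exact isNowhereDense_empty
    · exact (h.2.2.2.2 _ _ hmod).mono (inter_subset_inter (hED _) (hED _))

end RegularPeriodicDecomposition

/-- A transitive dendrite map without terminal decomposition admits, for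
every non-endpoint `q`, a connected regular periodic decomposition with `q` in the
intersection of two distinct members. -/
theorem stmt6 {D : Type*} [MetricSpace D] [CompactSpace D] [ConnectedSpace D]
    (hD : IsDendrite D) {f : D → D} (hf : Continuous f) (htrans : TopTransitive f)
    (hterm : ¬ HasTerminalDecomp f) :
    ∀ q : D, ¬ IsEndpointOf D q →
      ∃ (m : ℕ) (Ds : ZMod m → Set D), IsRegPerDecomp f m Ds ∧
        (∀ i, IsConnected (Ds i)) ∧ ∃ i j, i ≠ j ∧ q ∈ Ds i ∩ Ds j := by
  intro q hq
  have := hD.locallyConnectedSpace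
  obtain ⟨A, B, hA, hB, hcover, hAne, hBne, hAB⟩ : ∃ A B : Set D, IsOpen A ∧ IsOpen B ∧
      {q}ᶜ ⊆ A ∪ B ∧ A.Nonempty ∧ B.Nonempty ∧ Disjoint A B := by
    unfold IsEndpointOf IsPreconnected at hq
    push Not at hq
    obtain ⟨u, v, hu, hv, huv, hun, hvn, he⟩ := hq
    refine ⟨{q}ᶜ ∩ u, {q}ᶜ ∩ v, isOpen_compl_singleton.inter hu, isOpen_compl_singleton.inter hv,
      fun x hx => (huv hx).imp (And.intro hx) (And.intro hx), hun, hvn, ?_⟩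
    rw [Set.disjoint_left]
    rintro x ⟨hx, hxu⟩ ⟨-, hxv⟩
    exact (he ▸ (⟨hx, hxu, hxv⟩ : x ∈ {q}ᶜ ∩ (u ∩ v)) : x ∈ (∅ : Set D))
  obtain ⟨a, ha, hAa⟩ := htrans A A hA hA hAne hAne
  obtain ⟨b, hb, hBb⟩ := htrans B B hB hB hBne hBne
  obtain ⟨m, Ds, hm, h⟩ :=
    exists_isRegPerDecomp_lt_length (htrans.surjective hf) hterm (max a b)
  obtain ⟨l, Es, hml, hE, hconn⟩ := h.exists_connected hf htrans
  refine ⟨l, Es, hE, hconn, ?_⟩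
  by_contra! hno
  obtain ⟨i, hi⟩ := mem_iUnion.1 (hE.2.2.1.symm ▸ mem_univ q)
  have hlong : ∀ (U : Set D) (n : ℕ), IsOpen U → 0 < n → n < l →
      (f^[n] '' U ∩ U).Nonempty → ¬ U ⊆ Es i := by
    rintro U n hU hn hnl ⟨y, hyU, hy⟩ hUE
    have hi : i + n = i := hE.eq_of_inter_interior_nonempty
      ⟨y, hE.image_iterate n i ▸ image_mono hUE hyU, interior_maximal hUE hU hy⟩
    exact Nat.not_dvd_of_pos_of_lt hn hnl
      ((ZMod.natCast_eq_zero_iff n l).1 (add_eq_left.1 hi))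
  rcases hE.subset_of_separation hconn (fun j hj => by_contra fun hne => hno j i hne ⟨hj, hi⟩)
    hA hB hcover hAB with hAE | hBE
  · exact hlong A a hA ha (by omega) hAa hAE
  · exact hlong B b hB hb (by omega) hBb hBE
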